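/- arXiv:1011.2128 — 4 statements merged into one kernel-verified Lean document; each statement's English description precedes it below -/
import Mathlib

section
/- Suppose all crossings of γ are simple. If p is injective on every closed interval of length ℓ − 2π (i.e., for every a ∈ ℝ the restriction of p to [a, a + ℓ − 2π] is injective), then p is injective on all of ℝ. -/
open Real Set

/-- A continuous function on a preconnected set whose exponential is constant is constant. -/
theorem const_of_exp_const {s : Set ℝ} (hs : IsPreconnected s) {g : ℝ → ℂ}
    (hg : ContinuousOn g s) {c : ℂ} (h : ∀ a ∈ s, Complex.exp (g a) = c)
    {a b : ℝ} (ha : a ∈ s) (hb : b ∈ s) : g a = g b := by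
  refine Complex.isCoveringMap_exp.constOn_of_comp hs hg ?_ ha hb
  intro x hx y hy
  apply Subtype.ext
  simp [h x hx, h y hy]

/-- Continuous logarithms exist on the plane. -/
theorem exists_log (G : ℝ × ℝ → ℂ) (hG : Continuous G) (h0 : ∀ z, G z ≠ 0) :
    ∃ Φ : ℝ × ℝ → ℂ, Continuous Φ ∧ ∀ z, Complex.exp (Φ z) = G z := by
  obtain ⟨F, ⟨-, hF⟩, -⟩ := Complex.isCoveringMap_exp.existsUnique_continuousMap_lifts
    (⟨fun z => ⟨G z, h0 z⟩, by fun_prop⟩ : C(ℝ × ℝ, {z : ℂ // z ≠ 0})) (0, 0)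
    (Complex.log (G (0, 0))) (by
      apply Subtype.ext
      simpa using Complex.exp_log (h0 (0, 0)))
  refine ⟨F, F.continuous, fun z => ?_⟩
  exact congrArg Subtype.val (congrFun hF z)

/-- The topological core: the smallest positive crossing distance of a curve equivariant
under a translation cannot exceed the period. -/
theorem core (ℓ : ℝ) (hℓ : 0 < ℓ) (q : ℝ → ℂ) (hq : Continuous q) (w : ℂ)
    (hper : ∀ s, q (s + ℓ) = q s + w) (D x : ℝ) (hD : ℓ < D) (hx : q (x + D) = q x)
    (hmin : ∀ s d, 0 < d → d < D → q (s + d) ≠ q s) : False := by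
  set a := min ℓ (D - ℓ) with ha
  set b := max ℓ (D - ℓ) with hb
  have hab : a ≤ b := min_le_max
  have ha0 : 0 < a := lt_min hℓ (by linarith)
  have hbD : b < D := max_lt hD (by linarith)
  set cl : ℝ → ℝ := fun d => max a (min b d) with hcl
  have hclc : Continuous cl := by fun_prop
  have hcl1 : ∀ d, a ≤ cl d := fun d => le_max_left _ _
  have hcl2 : ∀ d, cl d ≤ b := fun d => max_le hab (min_le_left _ _)
  have hcl3 : ∀ d, a ≤ d → d ≤ b → cl d = d := fun d h1 h2 => by
    simp [hcl, min_eq_right h2, max_eq_right h1]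
  obtain ⟨Φ, hΦ, hexp⟩ := exists_log (fun z => q (z.1 + cl z.2) - q z.1) (by fun_prop)
    (fun z => sub_ne_zero.2 (hmin _ _ (ha0.trans_le (hcl1 _)) ((hcl2 _).trans_lt hbD)))
  have hal : a ≤ ℓ := min_le_left _ _
  have hbl : ℓ ≤ b := le_max_left _ _
  have haD : a ≤ D - ℓ := min_le_right _ _
  have hbD' : D - ℓ ≤ b := le_max_right _ _
  -- at distance ℓ the logarithm is constant
  have hK : ∀ s t, Φ (s, ℓ) = Φ (t, ℓ) := fun s t =>
    const_of_exp_const (s := univ) isPreconnected_univ (g := fun s => Φ (s, ℓ))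
      (by fun_prop) (c := w)
      (fun s _ => by rw [hexp]; simp [hcl3 ℓ hal hbl, hper]) (mem_univ _) (mem_univ _)
  -- periodicity
  have hP : ∀ s d, Φ (s + ℓ, d) = Φ (s, d) := fun s d => by
    have := const_of_exp_const (s := univ) isPreconnected_univ
      (g := fun d => Φ (s + ℓ, d) - Φ (s, d)) (by fun_prop) (c := 1)
      (fun d _ => by
        have hne := Complex.exp_ne_zero (Φ (s, d))
        rw [Complex.exp_sub, div_eq_one_iff_eq hne, hexp, hexp]
        have : s + ℓ + cl d = (s + cl d) + ℓ := by ring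
        simp only [this, hper]; ring) (mem_univ d) (mem_univ ℓ)
    simp only [hK (s + ℓ) s, sub_self] at this
    exact sub_eq_zero.1 this
  have key : ∀ u ∈ uIcc (x + ℓ) (x + D - ℓ),
      Complex.exp (Φ (u, x + D - u) - Φ (x, u - x)) = -1 := fun u hu => by
    rw [mem_uIcc] at hu
    have h1 : a ≤ u - x ∧ u - x ≤ b ∧ a ≤ x + D - u ∧ x + D - u ≤ b := by
      rcases hu with hu | hu <;> refine ⟨?_, ?_, ?_, ?_⟩ <;> linarith
    have hne := Complex.exp_ne_zero (Φ (x, u - x))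
    rw [Complex.exp_sub, div_eq_iff hne, hexp, hexp]
    simp only [hcl3 _ h1.1 h1.2.1, hcl3 _ h1.2.2.1 h1.2.2.2, add_sub_cancel, hx]
    ring
  have hc := const_of_exp_const (isPreconnected_uIcc)
    (g := fun u => Φ (u, x + D - u) - Φ (x, u - x)) (by fun_prop) key
    left_mem_uIcc right_mem_uIcc
  have hk := key _ left_mem_uIcc
  have e1 : x + D - (x + ℓ) = D - ℓ := by ring
  have e2 : x + ℓ - x = ℓ := by ring
  have e3 : x + D - (x + D - ℓ) = ℓ := by ring
  have e4 : x + D - ℓ - x = D - ℓ := by ring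
  simp only [e1, e2, e3, e4, hP] at hc hk
  rw [hK (x + D - ℓ) x] at hc
  have : Φ (x, D - ℓ) - Φ (x, ℓ) = 0 := by linear_combination hc / 2
  rw [this, Complex.exp_zero] at hk
  norm_num at hk

/-- If all crossings of the periodic curve `γ` are simple and `p` is
injective on every closed interval of length `ℓ - 2π`, then `p` is injective. -/
theorem stmt_0 (ℓ : ℝ) (p : ℝ → ℝ × ℝ)
    (hℓ : 2 * Real.pi < ℓ)
    (hsmooth : ContDiff ℝ (⊤ : ℕ∞) p)
    (hspeed : ∀ s : ℝ, ((deriv p s).1) ^ 2 + ((deriv p s).2) ^ 2 = 1)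
    (hper : ∀ s : ℝ, p (s + ℓ) = p s + (2 * Real.pi, 0))
    (hsimple : ∀ s₁ s₂ : ℝ, s₁ ≠ s₂ → p s₁ = p s₂ →
      deriv p s₁ ≠ deriv p s₂ ∧ ∀ t : ℝ, p t = p s₁ → t = s₁ ∨ t = s₂)
    (hinj : ∀ a : ℝ, Set.InjOn p (Set.Icc a (a + (ℓ - 2 * Real.pi)))) :
    Function.Injective p := by
  have hpi := Real.pi_pos
  have hℓ0 : 0 < ℓ := by linarith
  have hpc : Continuous p := hsmooth.continuous
  have hdiff : Differentiable ℝ p := hsmooth.differentiable (by simp)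
  have hlip : LipschitzWith 1 p := by
    refine lipschitzWith_of_nnnorm_deriv_le hdiff fun s => ?_
    rw [← NNReal.coe_le_coe, coe_nnnorm, NNReal.coe_one, Prod.norm_def]
    have := hspeed s
    refine max_le ?_ ?_ <;> rw [Real.norm_eq_abs, abs_le_one_iff_mul_self_le_one] <;> nlinarith
  -- every crossing distance exceeds ℓ
  have hbig : ∀ s d, 0 < d → p (s + d) = p s → ℓ < d := by
    intro s d hd h
    by_contra! hle
    rcases le_or_gt d (ℓ - 2 * Real.pi) with h1 | h1
    · have := hinj s (show s + d ∈ _ from ⟨by linarith, by linarith⟩)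
        (show s ∈ _ from ⟨le_rfl, by linarith⟩) h
      linarith
    · have h2 := hlip.dist_le_mul (s + ℓ) (s + d)
      rw [hper, h, dist_eq_norm, add_sub_cancel_left, Real.dist_eq,
        abs_of_nonneg (by linarith), Prod.norm_def] at h2
      have h3 := (le_max_left _ _).trans h2
      simp only [Real.norm_eq_abs, NNReal.coe_one, abs_of_pos (show (0:ℝ) < 2 * Real.pi by linarith)] at h3
      linarith
  by_contra hni
  have hex : ∃ s d, 0 < d ∧ p (s + d) = p s := by
    simp only [Function.Injective, not_forall] at hni
    obtain ⟨s, t, h, hne⟩ := hni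
    rcases lt_or_gt_of_ne hne with h1 | h1
    · exact ⟨s, t - s, by linarith, by simp [h]⟩
    · exact ⟨t, s - t, by linarith, by simp [h]⟩
  obtain ⟨s₀, d₀, hd₀, h₀⟩ := hex
  have hmove : ∀ s d, p (s + d) = p s → ∃ y ∈ Icc 0 ℓ, p (y + d) = p y := by
    intro s d h
    have hP : Function.Periodic (fun s => p (s + d) - p s) ℓ := fun s => by
      have : s + ℓ + d = (s + d) + ℓ := by ring
      simp only [this, hper]; abel
    obtain ⟨y, hy, he⟩ := hP.exists_mem_Ico₀ hℓ0 s
    refine ⟨y, Ico_subset_Icc_self hy, ?_⟩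
    simp only [h, sub_self] at he
    exact sub_eq_zero.1 he.symm
  set K : Set (ℝ × ℝ) := (Icc 0 ℓ ×ˢ Icc ℓ d₀) ∩ {z | p (z.1 + z.2) = p z.1} with hK
  have hKc : IsCompact K := (isCompact_Icc.prod isCompact_Icc).inter_right
    (isClosed_eq (by fun_prop) (by fun_prop))
  have hmem : ∀ s d, 0 < d → d ≤ d₀ → p (s + d) = p s → ∃ y, (y, d) ∈ K := by
    intro s d hd hd' h
    obtain ⟨y, hy, he⟩ := hmove s d h
    exact ⟨y, ⟨hy, (hbig s d hd h).le, hd'⟩, he⟩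
  obtain ⟨y₀, hy₀⟩ := hmem s₀ d₀ hd₀ le_rfl h₀
  obtain ⟨⟨x, D⟩, hz, hzmin⟩ := hKc.exists_isMinOn ⟨_, hy₀⟩ (continuous_snd.continuousOn)
  have hDpos : 0 < D := hℓ0.trans_le hz.1.2.1
  have hDd : D ≤ d₀ := hz.1.2.2
  have hx : p (x + D) = p x := hz.2
  have hmin : ∀ s d, 0 < d → d < D → p (s + d) ≠ p s := by
    intro s d hd hdD h
    obtain ⟨y, hy⟩ := hmem s d hd (hdD.le.trans hDd) h
    have : D ≤ d := hzmin hy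
    linarith
  set e := Complex.equivRealProdCLM.symm
  refine core ℓ hℓ0 (fun s => e (p s)) (e.continuous.comp hpc) (e (2 * Real.pi, 0))
    (fun s => by simp only [hper, map_add]) D x (hbig x D hDpos hx) (by simp only [hx]) ?_
  intro s d hd hdD h
  exact hmin s d hd hdD (e.injective h)
end

section
/- Suppose that all crossings of the cylinder projection Γ are simple. Let a < b in [0, ℓ] and let k be an integer with k > 1 such that u(b) = u(a) + 2kπ and v(b) = v(a) (so the loop {P(s) : s ∈ [a, b]} has winding number k > 1). Then there exist a₁, b₁ with a ≤ a₁ < b₁ < b such that u(b₁) = u(a₁) + 2π and v(b₁) = v(a₁) (a sub-loop with winding number exactly 1). -/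
open Real Set

/-- Continuous logarithm of a nonvanishing function on the plane. -/
theorem exists_log_lift (f : ℝ × ℝ → ℂ) (hf : Continuous f) (h0 : ∀ x, f x ≠ 0) :
    ∃ F : ℝ × ℝ → ℂ, Continuous F ∧ ∀ x, Complex.exp (F x) = f x := by
  obtain ⟨F, ⟨-, hF⟩, -⟩ := Complex.isCoveringMapOn_exp.existsUnique_continuousMap_lifts
    (⟨f, hf⟩ : C(ℝ × ℝ, ℂ)) (a₀ := (0, 0)) (e₀ := Complex.log (f (0, 0)))
    (Complex.exp_log (h0 _)) (fun a => h0 a)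
  exact ⟨F, F.continuous, fun x => congrFun hF x⟩

/-- The angle along a path starting at `-1` in the closed lower half plane does not drop below
its initial value. -/
theorem angle_ge (F : ℝ → ℂ) (hF : Continuous F) (h0 : Complex.exp (F 0) = -1)
    (hneg : ∀ s, (Complex.exp (F s)).im ≤ 0) (x : ℝ) : (F 0).im ≤ (F x).im := by
  by_contra! hlt
  set d := min (π / 2) ((F 0).im - (F x).im) with hd
  have hd0 : 0 < d := lt_min (by positivity) (by linarith)
  have hd1 : d ≤ π / 2 := min_le_left _ _
  have hd2 : d ≤ (F 0).im - (F x).im := min_le_right _ _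
  have hc : Continuous fun s => (F s).im := Complex.continuous_im.comp hF
  have hmem : (F 0).im - d ∈ Set.range fun s => (F s).im :=
    mem_range_of_exists_le_of_exists_ge hc ⟨x, by linarith⟩ ⟨0, by linarith⟩
  obtain ⟨s, hs⟩ := hmem
  have h1 := hneg s
  simp only at hs
  rw [Complex.exp_im, hs, Real.sin_sub] at h1
  have hre := congrArg Complex.re h0
  have him := congrArg Complex.im h0
  rw [Complex.exp_re] at hre
  rw [Complex.exp_im] at him
  simp only [Complex.neg_re, Complex.one_re, Complex.neg_im, Complex.one_im, neg_zero] at hre him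
  have e0 := Real.exp_pos (F 0).re
  have e1 := Real.exp_pos (F s).re
  have hsin : Real.sin (F 0).im = 0 := by
    rcases mul_eq_zero.1 him with h | h
    · linarith
    · exact h
  have hcos : Real.cos (F 0).im < 0 := by
    by_contra! h
    have := mul_nonneg e0.le h
    linarith
  have hsd : 0 < Real.sin d := Real.sin_pos_of_pos_of_lt_pi hd0 (by linarith [Real.pi_pos])
  rw [hsin] at h1
  have : 0 < Real.exp (F s).re * (-(Real.cos (F 0).im) * Real.sin d) :=
    mul_pos e1 (mul_pos (by linarith) hsd)
  nlinarith

/-- The periodic core of the argument. -/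
theorem periodic_core (g : ℝ → ℂ) (hg : Continuous g) (L k : ℝ) (hL : 0 < L) (hk : 1 < k)
    (hper : ∀ t, g (t + L) = g t + k)
    (hne : ∀ t, ∀ r ∈ Icc 0 L, g (t + r) - g t ≠ 1)
    (tM tm : ℝ) (hM : ∀ s, (g s).im ≤ (g tM).im) (hm : ∀ s, (g tm).im ≤ (g s).im) : False := by
  set c : ℝ → ℝ := fun r => max 0 (min r L) with hc
  have hcc : Continuous c := by fun_prop
  have hcm : ∀ r, c r ∈ Icc 0 L := fun r =>
    ⟨le_max_left _ _, max_le hL.le (min_le_right _ _)⟩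
  have hc0 : c 0 = 0 := by simp [hc, hL.le]
  have hcL : c L = L := by simp [hc, hL.le]
  obtain ⟨F, hF, hexp⟩ := exists_log_lift (fun x => g (x.1 + c x.2) - g x.1 - 1)
    (by fun_prop) (fun x h => hne x.1 (c x.2) (hcm _) (sub_eq_zero.1 h))
  have hz : ∀ t, Complex.exp (F (t, 0)) = -1 := fun t => by rw [hexp]; simp [hc0]
  have hl : ∀ t, Complex.exp (F (t, L)) = ((k - 1 : ℝ) : ℂ) := fun t => by
    rw [hexp]; simp [hcL, hper]
  have hDc : Continuous fun t => (F (t, L)).im - (F (t, 0)).im := by fun_prop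
  have h1 : (F (tM, 0)).im ≤ (F (tM, L)).im := by
    refine angle_ge (fun s => F (tM, s)) (by fun_prop) (hz _) (fun s => ?_) L
    rw [hexp]
    simpa using hM _
  have h2 : (F (tm, L)).im ≤ (F (tm, 0)).im := by
    have := angle_ge (fun s => (starRingEnd ℂ) (F (tm, s)))
      (Complex.continuous_conj.comp (by fun_prop)) (by rw [Complex.exp_conj, hz]; simp)
      (fun s => by
        rw [Complex.exp_conj, hexp]
        simpa using hm _) L
    simpa using this
  have hmem : (0 : ℝ) ∈ Set.range fun t => (F (t, L)).im - (F (t, 0)).im :=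
    mem_range_of_exists_le_of_exists_ge hDc ⟨tm, by linarith⟩ ⟨tM, by linarith⟩
  obtain ⟨t, ht⟩ := hmem
  simp only at ht
  have ha := congrArg Complex.re (hz t)
  have hb := congrArg Complex.re (hl t)
  rw [Complex.exp_re] at ha hb
  rw [show (F (t, L)).im = (F (t, 0)).im by linarith] at hb
  rw [Complex.ofReal_re] at hb
  simp only [Complex.neg_re, Complex.one_re] at ha
  have e0 := Real.exp_pos (F (t, 0)).re
  have e1 := Real.exp_pos (F (t, L)).re
  have hcos : Real.cos (F (t, 0)).im < 0 := by
    by_contra! h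
    have := mul_nonneg e0.le h
    linarith
  have := mul_neg_of_pos_of_neg e1 hcos
  linarith

/-- Hopf-type dichotomy with orientation: a path with displacement `k > 1` has an (oriented)
chord `1` or `k - 1`. -/
theorem chord_dichotomy (γ : ℝ → ℂ) (hγ : Continuous γ) (a b k : ℝ) (hab : a < b) (hk : 1 < k)
    (h : γ b = γ a + k) :
    ∃ t s, a ≤ t ∧ t < s ∧ s ≤ b ∧ (γ s = γ t + 1 ∨ γ s = γ t + (k - 1)) := by
  by_contra! hno
  set L := b - a with hLd
  have hL : 0 < L := by linarith
  have : Fact (0 < L) := ⟨hL⟩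
  have haL : a + L = b := by linarith
  have hLC : (L : ℂ) ≠ 0 := by exact_mod_cast hL.ne'
  set f : ℝ → ℂ := fun x => γ x - (k / L) * x with hf
  have hfc : Continuous f := by fun_prop
  have hfe : f a = f (a + L) := by
    simp only [hf]
    rw [haL, h, ← haL]
    push_cast
    field_simp
    ring
  set q := AddCircle.liftIco L a f with hq
  have hqc : Continuous q := AddCircle.liftIco_continuous hfe hfc.continuousOn
  set g : ℝ → ℂ := fun x => q (x : AddCircle L) + (k / L) * x with hgd
  have hcoe : Continuous fun x : ℝ => (x : AddCircle L) := AddCircle.continuous_mk' L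
  have hg : Continuous g := by fun_prop
  have hper : ∀ t, g (t + L) = g t + k := fun t => by
    simp only [hgd, AddCircle.coe_add_period]
    push_cast
    field_simp
    ring
  have hgγ : ∀ x ∈ Icc a b, g x = γ x := by
    have h1 : ∀ x ∈ Ico a (a + L), g x = γ x := fun x hx => by
      simp only [hgd, hq]
      rw [AddCircle.liftIco_coe_apply hx]
      simp [hf]
    intro x hx
    rcases hx.2.lt_or_eq with hlt | rfl
    · exact h1 x ⟨hx.1, by linarith⟩
    · rw [← haL, hper, h1 a ⟨le_rfl, by linarith⟩, haL, h]
  have him : ∀ x : ℝ, (g x).im = (q (x : AddCircle L)).im := fun x => by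
    have : (k / L * x : ℂ) = ((k / L * x : ℝ) : ℂ) := by push_cast; ring
    simp only [hgd]
    rw [this, Complex.add_im, Complex.ofReal_im, add_zero]
  have hqi : Continuous fun y => (q y).im := Complex.continuous_im.comp hqc
  obtain ⟨yM, -, hyM⟩ := isCompact_univ.exists_isMaxOn (univ_nonempty) hqi.continuousOn
  obtain ⟨ym, -, hym⟩ := isCompact_univ.exists_isMinOn (univ_nonempty) hqi.continuousOn
  obtain ⟨tM, rfl⟩ := QuotientAddGroup.mk_surjective yM
  obtain ⟨tm, rfl⟩ := QuotientAddGroup.mk_surjective ym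
  -- chord `1` is excluded for base points in the fundamental interval
  have hne0 : ∀ t ∈ Ico a (a + L), ∀ r ∈ Icc 0 L, g (t + r) - g t ≠ 1 := by
    intro t ht r hr heq
    have hk0 : ((k - 1 : ℝ) : ℂ) ≠ 0 := by
      have : k - 1 ≠ 0 := by linarith
      exact_mod_cast this
    have htm : t ∈ Icc a b := ⟨ht.1, by linarith [ht.2]⟩
    by_cases hs : t + r ≤ b
    · rcases hr.1.lt_or_eq with hr0 | hr0
      · rw [hgγ t htm, hgγ (t + r) ⟨by linarith [ht.1], hs⟩] at heq
        exact (hno t (t + r) ht.1 (by linarith) hs).1 (by rw [← heq]; ring)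
      · rw [← hr0] at heq
        simp at heq
    · push Not at hs
      have hg' := hper (t + r - L)
      rw [sub_add_cancel] at hg'
      have hm : t + r - L ∈ Icc a b := ⟨by linarith, by linarith [ht.2, hr.2]⟩
      rcases (show t + r - L ≤ t by linarith [hr.2]).lt_or_eq with hlt | he
      · rw [hg', hgγ t htm, hgγ _ hm] at heq
        refine (hno (t + r - L) t hm.1 hlt htm.2).2 ?_
        linear_combination -heq
      · rw [hg', he] at heq
        apply hk0
        push_cast
        linear_combination heq
  refine periodic_core g hg L k hL hk hper (fun t r hr heq => ?_) tM tm
    (fun s => by rw [him, him]; exact hyM (mem_univ _))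
    (fun s => by rw [him, him]; exact hym (mem_univ _))
  have hP : Function.Periodic (fun t => g (t + r) - g t) L := fun t => by
    simp only
    rw [show t + L + r = t + r + L by ring, hper, hper]
    ring
  obtain ⟨y, hy, hyt⟩ := hP.exists_mem_Ico hL t a
  exact hne0 y hy r hr (hyt ▸ heq)

/-- A path with integer displacement `n + 1` has an oriented unit chord. -/
theorem unit_chord (γ : ℝ → ℂ) (hγ : Continuous γ) (n : ℕ) : ∀ a b : ℝ, a < b →
    γ b = γ a + ((n : ℂ) + 1) → ∃ t s, a ≤ t ∧ t < s ∧ s ≤ b ∧ γ s = γ t + 1 := by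
  induction n with
  | zero =>
    intro a b hab h
    exact ⟨a, b, le_rfl, hab, le_rfl, by simpa using h⟩
  | succ n ih =>
    intro a b hab h
    have hn : (0 : ℝ) ≤ n := n.cast_nonneg
    obtain ⟨t, s, h1, h2, h3, h4⟩ := chord_dichotomy γ hγ a b ((n : ℝ) + 2) hab (by linarith)
      (by rw [h]; push_cast; ring)
    rcases h4 with h4 | h4
    · exact ⟨t, s, h1, h2, h3, h4⟩
    · obtain ⟨t', s', g1, g2, g3, g4⟩ := ih t s h2 (by rw [h4]; push_cast; ring)
      exact ⟨t', s', h1.trans g1, g2, g3.trans h3, g4⟩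

/-- If all crossings of the cylinder projection `Γ` are simple and a
loop `{P(s) : s ∈ [a, b]}` has winding number `k > 1`, then it contains a sub-loop
with winding number exactly `1`. -/
theorem stmt_4 (ℓ : ℝ) (p : ℝ → ℝ × ℝ)
    (hℓ : 2 * Real.pi < ℓ)
    (hsmooth : ContDiff ℝ (⊤ : ℕ∞) p)
    (hspeed : ∀ s : ℝ, ((deriv p s).1) ^ 2 + ((deriv p s).2) ^ 2 = 1)
    (hper : ∀ s : ℝ, p (s + ℓ) = p s + (2 * Real.pi, 0))
    (hsimple : ∀ s t : ℝ, s ∈ Set.Ico 0 ℓ → t ∈ Set.Ico 0 ℓ → s ≠ t →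
      ((∃ m : ℤ, (p s).1 - (p t).1 = 2 * (m : ℝ) * Real.pi) ∧ (p s).2 = (p t).2) →
      deriv p s ≠ deriv p t ∧
        ∀ r ∈ Set.Ico 0 ℓ,
          ((∃ m : ℤ, (p r).1 - (p s).1 = 2 * (m : ℝ) * Real.pi) ∧ (p r).2 = (p s).2) →
          r = s ∨ r = t)
    (a b : ℝ) (k : ℤ)
    (ha : a ∈ Set.Icc 0 ℓ) (hb : b ∈ Set.Icc 0 ℓ) (hab : a < b)
    (hk : 1 < k)
    (hu : (p b).1 = (p a).1 + 2 * (k : ℝ) * Real.pi)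
    (hv : (p b).2 = (p a).2) :
    ∃ a₁ b₁ : ℝ, a ≤ a₁ ∧ a₁ < b₁ ∧ b₁ < b ∧
      (p b₁).1 = (p a₁).1 + 2 * Real.pi ∧ (p b₁).2 = (p a₁).2 := by

  have hpi : (π : ℂ) ≠ 0 := by exact_mod_cast Real.pi_ne_zero
  have hpc : Continuous p := hsmooth.continuous
  set γ : ℝ → ℂ := fun s => (((p s).1 : ℂ) + ((p s).2 : ℂ) * Complex.I) / (2 * π) with hγd
  have hγ : Continuous γ := by fun_prop
  have key : ∀ s t : ℝ, γ s = γ t + 1 → (p s).1 = (p t).1 + 2 * π ∧ (p s).2 = (p t).2 := by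
    intro s t h
    have h' : ((p s).1 : ℂ) + ((p s).2 : ℂ) * Complex.I
        = (((p t).1 + 2 * π : ℝ) : ℂ) + ((p t).2 : ℂ) * Complex.I := by
      simp only [hγd] at h
      field_simp at h
      push_cast
      linear_combination h
    constructor
    · simpa using congrArg Complex.re h'
    · simpa using congrArg Complex.im h'
  obtain ⟨n, hn⟩ : ∃ n : ℕ, k = n + 2 := ⟨(k - 2).toNat, by omega⟩
  have hγk : γ b = γ a + ((n : ℂ) + 2) := by
    simp only [hγd]
    rw [hu, hv, hn]
    push_cast
    field_simp
    ring
  obtain ⟨t, s, h1, h2, h3, h4⟩ := unit_chord γ hγ (n + 1) a b hab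
    (by rw [hγk]; push_cast; ring)
  rcases h3.lt_or_eq with hlt | rfl
  · exact ⟨t, s, h1, h2, hlt, key s t h4⟩
  · have ht : γ t = γ a + ((n : ℂ) + 1) := by linear_combination hγk - h4
    have hat : a < t := by
      rcases h1.lt_or_eq with h | rfl
      · exact h
      · exfalso
        have : ((n : ℂ) + 1) = 0 := by linear_combination -ht
        exact Nat.cast_add_one_ne_zero n this
    obtain ⟨t', s', g1, g2, g3, g4⟩ := unit_chord γ hγ n a t hat ht
    exact ⟨t', s', g1, g2, g3.trans_lt h2, key s' t' g4⟩
end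

section
/- If p is not injective, then p is not injective on some closed interval of length ℓ: there exist a ∈ ℝ and s ≠ t in [a, a + ℓ] with p(s) = p(t). -/
open Real Set

/-- Continuous logarithm of a nonvanishing function on the plane, normalised at a point. -/
lemma aux_lift (f : ℝ × ℝ → ℂ) (hf : Continuous f) (h0 : ∀ x, f x ≠ 0) (a : ℝ × ℝ) (e : ℂ)
    (he : Complex.exp e = f a) :
    ∃ g : ℝ × ℝ → ℂ, Continuous g ∧ g a = e ∧ ∀ x, Complex.exp (g x) = f x := by
  obtain ⟨F, ⟨h1, h2⟩, -⟩ := Complex.isCoveringMap_exp.existsUnique_continuousMap_lifts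
    (⟨fun x => ⟨f x, h0 x⟩, by fun_prop⟩ : C(ℝ × ℝ, {z : ℂ // z ≠ 0})) a e (Subtype.ext he)
  exact ⟨F, F.continuous, h1, fun x => congrArg Subtype.val (congrFun h2 x)⟩

/-- A continuous logarithm of a constant is constant. -/
lemma aux_const (g : ℝ → ℂ) (hg : Continuous g) (w : ℂ) (h : ∀ s, Complex.exp (g s) = w)
    (s t : ℝ) : g s = g t := by
  have := Complex.isCoveringMap_exp.eq_of_comp_eq hg (continuous_const (y := g t))
    (by funext x; exact Subtype.ext ((h x).trans (h t).symm)) t rfl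
  exact congrFun this s

lemma aux_half (φ : ℝ → ℝ) (hφ : Continuous φ) (h : ∀ s, 0 ≤ sin (φ s)) (s₀ : ℝ)
    (h0 : φ s₀ ∈ Icc 0 π) (s : ℝ) : φ s ∈ Icc 0 π := by
  have hpi := Real.pi_pos
  constructor
  · by_contra! hs
    obtain ⟨u, hu⟩ := mem_range_of_exists_le_of_exists_ge (c := max (φ s) (-(π / 2))) hφ ⟨s, le_max_left _ _⟩
      ⟨s₀, (max_le hs.le (by linarith)).trans h0.1⟩
    have h1 := h u
    rw [hu] at h1
    have := sin_neg_of_neg_of_neg_pi_lt (x := max (φ s) (-(π / 2)))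
      (max_lt hs (by linarith)) (lt_max_of_lt_right (by linarith))
    linarith
  · by_contra! hs
    obtain ⟨u, hu⟩ := mem_range_of_exists_le_of_exists_ge (c := min (φ s) (3 * π / 2)) hφ
      ⟨s₀, h0.2.trans (le_min hs.le (by linarith))⟩ ⟨s, min_le_left _ _⟩
    have h1 := h u
    rw [hu] at h1
    have h3 : π < min (φ s) (3 * π / 2) := lt_min hs (by linarith)
    have h4 : min (φ s) (3 * π / 2) ≤ 3 * π / 2 := min_le_right _ _
    have := sin_pos_of_pos_of_lt_pi (x := min (φ s) (3 * π / 2) - π) (by linarith) (by linarith)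
    rw [sin_sub_pi] at this
    linarith

lemma aux_sin (z w : ℂ) (h : Complex.exp z = w) : (0 ≤ sin z.im ↔ 0 ≤ w.im) ∧
    (sin z.im ≤ 0 ↔ w.im ≤ 0) := by
  subst h
  rw [Complex.exp_im]
  have := Real.exp_pos z.re
  constructor
  · constructor
    · intro h; positivity
    · intro h; exact nonneg_of_mul_nonneg_right h this
  · constructor
    · intro h; exact mul_nonpos_of_nonneg_of_nonpos this.le h
    · intro h; exact nonpos_of_mul_nonpos_right h this

/-- An ordered chord twice as long forces an ordered chord. -/
lemma aux_double (q : ℝ → ℂ) (hq : Continuous q) (L : ℝ) (hL : 0 < L) (c d : ℝ) (hcd : c ≤ d)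
    (h : ∀ s t, c ≤ s → s ≤ t → t ≤ d → q t - q s ≠ L) : q d - q c ≠ 2 * L := by
  intro hd
  set k : ℝ → ℝ := fun t => max c (min d t) with hk
  have hkc : Continuous k := by fun_prop
  have hk1 : ∀ t, c ≤ k t := fun t => le_max_left _ _
  have hk2 : ∀ t, k t ≤ d := fun t => max_le hcd (min_le_left _ _)
  have kc : k c = c := by simp [hk]
  have kd : k d = d := by simp [hk, hcd]
  set f : ℝ × ℝ → ℂ := fun x => q (max (k x.1) (k x.2)) - q (min (k x.1) (k x.2)) - L with hf
  have hfc : Continuous f := by fun_prop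
  have hf0 : ∀ x, f x ≠ 0 := fun x => sub_ne_zero.2
    (h _ _ (le_min (hk1 _) (hk1 _)) min_le_max (max_le (hk2 _) (hk2 _)))
  obtain ⟨g, hg, -, hge⟩ := aux_lift f hfc hf0 (c, c) _ (Complex.exp_log (hf0 (c, c)))
  have e1 : g (c, c) = g (d, d) := by
    refine aux_const (fun s => g (s, s)) (by fun_prop) (-L) (fun s => ?_) c d
    simp [hge, hf]
  have hE : ∀ t, Complex.exp (g (t, d) - g (c, t)) = -1 := by
    intro t
    rw [Complex.exp_sub, hge, hge, div_eq_iff (hf0 _)]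
    simp only [hf, kc, kd, max_eq_right (hk2 t), min_eq_left (hk2 t), max_eq_right (hk1 t),
      min_eq_left (hk1 t)]
    linear_combination hd
  have e2 := aux_const (fun t => g (t, d) - g (c, t)) (by fun_prop) (-1) hE c d
  have e3 := hE c
  have e4 : g (c, d) - g (c, c) = 0 := by
    rw [← e1] at e2
    linear_combination e2 / 2
  rw [e4] at e3
  norm_num at e3

/-- Hopf: the set of non-chords is additive. -/
lemma aux_hopf (q : ℝ → ℂ) (hq : Continuous q) (a b : ℝ) (ha : 0 < a) (hb : 0 < b)
    (T m : ℝ) (hT : ∀ t, (q t).im ≤ (q T).im) (hm : ∀ t, (q m).im ≤ (q t).im)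
    (h1 : ∀ s t, q t - q s ≠ a) (h2 : ∀ s t, q t - q s ≠ b) (s₀ t₀ : ℝ) :
    q t₀ - q s₀ ≠ a + b := by
  intro h0
  have hpi := Real.pi_pos
  set f : ℝ × ℝ → ℂ := fun x => q x.2 - q x.1 - a with hf
  set f' : ℝ × ℝ → ℂ := fun x => q x.2 - q x.1 + b with hf'
  have hf0 : ∀ x, f x ≠ 0 := fun x => sub_ne_zero.2 (h1 _ _)
  have hf0' : ∀ x, f' x ≠ 0 := fun x hx => h2 x.2 x.1 (by
    simp only [hf'] at hx; linear_combination -hx)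
  obtain ⟨g, hg, g0, hge⟩ := aux_lift f (by fun_prop) hf0 (T, T) (Real.log a + π * Complex.I) (by
    rw [Complex.exp_add, Complex.exp_pi_mul_I, ← Complex.ofReal_exp, Real.exp_log ha]; simp [hf])
  obtain ⟨g', hg', g0', hge'⟩ := aux_lift f' (by fun_prop) hf0' (T, T) (Real.log b) (by
    rw [← Complex.ofReal_exp, Real.exp_log hb]; simp [hf'])
  have d1 : g (m, m) = g (T, T) :=
    aux_const (fun s => g (s, s)) (by fun_prop) (-a) (fun s => by simp [hge, hf]) m T
  have d2 : g' (m, m) = g' (T, T) :=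
    aux_const (fun s => g' (s, s)) (by fun_prop) b (fun s => by simp [hge', hf']) m T
  have i1 : (g (T, T)).im = π := by simp [g0]
  have i2 : (g' (T, T)).im = 0 := by rw [g0']; exact Complex.ofReal_im _
  have A1 := aux_half (fun s => (g (s, T)).im) (by fun_prop)
    (fun s => (aux_sin _ _ (hge (s, T))).1.2 (by simp [hf]; exact hT s)) T
    (by simp only [i1]; constructor <;> linarith) s₀
  have A2 := aux_half (fun s => (g (s, m)).im - π) (by fun_prop)
    (fun s => by
      have := (aux_sin _ _ (hge (s, m))).2.2 (by simp [hf]; exact hm s)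
      rw [sin_sub_pi]; linarith) m
    (by simp only [d1, i1]; constructor <;> linarith) s₀
  have B1 := aux_half (fun s => (g' (s, T)).im) (by fun_prop)
    (fun s => (aux_sin _ _ (hge' (s, T))).1.2 (by simp [hf']; exact hT s)) T
    (by simp only [i2]; constructor <;> linarith) t₀
  have B2 := aux_half (fun s => (g' (s, m)).im + π) (by fun_prop)
    (fun s => by
      have := (aux_sin _ _ (hge' (s, m))).2.2 (by simp [hf']; exact hm s)
      rw [sin_add_pi]; linarith) m
    (by simp only [d2, i2]; constructor <;> linarith) t₀
  have hff : ∀ t, f (s₀, t) = f' (t₀, t) := fun t => by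
    simp only [hf, hf']; linear_combination h0
  have C := aux_const (fun t => g (s₀, t) - g' (t₀, t)) (by fun_prop) 1 (fun t => by
    rw [Complex.exp_sub, hge, hge', hff, div_self (hf0' _)]) T m
  have C' := congrArg Complex.im C
  simp only [Complex.sub_im, mem_Icc] at C' A1 A2 B1 B2
  have j1 : (g (s₀, T)).im = π := by linarith
  have j2 : (g' (t₀, T)).im = 0 := by linarith
  have k := congrArg Complex.re ((hge (s₀, T)).trans ((hff T).trans (hge' (t₀, T)).symm))
  rw [Complex.exp_re, Complex.exp_re, j1, j2, cos_pi, cos_zero] at k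
  have := Real.exp_pos (g (s₀, T)).re
  have := Real.exp_pos (g' (t₀, T)).re
  linarith

lemma aux_hopf_nat (q : ℝ → ℂ) (hq : Continuous q) (L : ℝ) (hL : 0 < L) (c d : ℝ) (hcd : c ≤ d)
    (h : ∀ s ∈ Icc c d, ∀ t ∈ Icc c d, q t - q s ≠ L) (n : ℕ) :
    ∀ s ∈ Icc c d, ∀ t ∈ Icc c d, q t - q s ≠ ((n + 1 : ℕ) * L : ℝ) := by
  set k : ℝ → ℝ := fun t => max c (min d t) with hk
  have hkc : Continuous k := by fun_prop
  have hkm : ∀ t, k t ∈ Icc c d := fun t => ⟨le_max_left _ _, max_le hcd (min_le_left _ _)⟩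
  have hke : ∀ t ∈ Icc c d, k t = t := fun t ht => by simp [hk, ht.1, ht.2]
  obtain ⟨T, hTm, hT⟩ := isCompact_Icc.exists_isMaxOn (nonempty_Icc.2 hcd)
    (f := fun t => (q t).im) (by fun_prop)
  obtain ⟨m, hmm, hm⟩ := isCompact_Icc.exists_isMinOn (nonempty_Icc.2 hcd)
    (f := fun t => (q t).im) (by fun_prop)
  have key : ∀ s t, q (k t) - q (k s) ≠ ((n + 1 : ℕ) * L : ℝ) := by
    induction n with
    | zero => intro s t; simpa using h _ (hkm s) _ (hkm t)
    | succ n ih =>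
      intro s t
      have := aux_hopf (fun t => q (k t)) (by fun_prop) ((n + 1 : ℕ) * L) L (by positivity) hL T m
        (fun t => by rw [hke T hTm]; exact hT (hkm t))
        (fun t => by rw [hke m hmm]; exact hm (hkm t)) ih (fun s t => h _ (hkm s) _ (hkm t)) s t
      convert this using 1
      push_cast
      ring
  intro s hs t ht
  have := key s t
  rwa [hke s hs, hke t ht] at this

lemma aux_main (q : ℝ → ℂ) (hq : Continuous q) (L ℓ : ℝ) (hL : 0 < L) (hℓ : 0 < ℓ)
    (hper : ∀ s, q (s + ℓ) = q s + L) (h0 : ∀ s t, s < t → t ≤ s + ℓ → q s ≠ q t) :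
    ∀ s t, s < t → q s ≠ q t := by
  have hLc : (L : ℂ) ≠ 0 := by exact_mod_cast hL.ne'
  have n1 : ∀ s t, s ≤ t → t < s + ℓ → q t - q s ≠ L := by
    intro s t h1 h2 h
    refine h0 t (s + ℓ) h2 (by linarith) ?_
    rw [hper]; linear_combination h
  have n2 : ∀ s t, s ≤ t → t < s + ℓ → q t - q s ≠ 2 * L := by
    intro s t h1 h2
    exact aux_double q hq L hL s t h1 (fun a b ha hab hb => n1 a b hab (by linarith))
  have n3 : ∀ s t, s ≤ t → t < s + ℓ → q s - q t ≠ L := by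
    intro s t h1 h2 h
    rcases h1.eq_or_lt with rfl | h1
    · exact hLc (by linear_combination -h)
    · refine n2 t (s + ℓ) h2.le (by linarith) ?_
      rw [hper]; linear_combination h
  have n4 : ∀ s t, s ≤ t → t < s + ℓ → ∀ n : ℕ, q s - q t ≠ ((n + 1 : ℕ) * L : ℝ) := by
    intro s t h1 h2 n
    refine aux_hopf_nat q hq L hL s t h1 ?_ n t ⟨h1, le_rfl⟩ s ⟨le_rfl, h1⟩
    intro a ha b hb
    rcases le_total a b with hab | hab
    · exact n1 a b hab (by linarith [ha.1, hb.2])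
    · exact n3 b a hab (by linarith [hb.1, ha.2])
  have hpn : ∀ (n : ℕ) s, q (s + n * ℓ) = q s + n * L := by
    intro n
    induction n with
    | zero => simp
    | succ n ih =>
      intro s
      have := hper (s + n * ℓ)
      rw [ih] at this
      rw [show s + ((n + 1 : ℕ) : ℝ) * ℓ = s + n * ℓ + ℓ by push_cast; ring, this]
      push_cast; ring
  intro s t hst h
  set k := ⌊(t - s) / ℓ⌋₊ with hk
  have f1 : (k : ℝ) * ℓ ≤ t - s := by
    rw [← le_div_iff₀ hℓ]; exact Nat.floor_le (div_nonneg (by linarith) hℓ.le)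
  have f2 : t - s < (k + 1) * ℓ := by
    rw [← div_lt_iff₀ hℓ]; exact Nat.lt_floor_add_one _
  have e := hpn k (t - k * ℓ)
  rw [sub_add_cancel] at e
  rcases hk' : k with _ | n
  · rw [hk'] at f2
    exact h0 s t hst (by simp at f2; linarith) h
  · refine n4 s (t - k * ℓ) (by linarith) (by linarith) n ?_
    rw [h, e, hk']; push_cast; ring

/-- If `p` is not injective, then `p` is not injective on some closed
interval of length `ℓ`. -/
theorem stmt_6 (ℓ : ℝ) (p : ℝ → ℝ × ℝ)
    (hℓ : 2 * Real.pi < ℓ)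
    (hsmooth : ContDiff ℝ (⊤ : ℕ∞) p)
    (hspeed : ∀ s : ℝ, ((deriv p s).1) ^ 2 + ((deriv p s).2) ^ 2 = 1)
    (hper : ∀ s : ℝ, p (s + ℓ) = p s + (2 * Real.pi, 0))
    (hni : ¬ Function.Injective p) :
    ∃ a s t : ℝ, s ∈ Set.Icc a (a + ℓ) ∧ t ∈ Set.Icc a (a + ℓ) ∧ s ≠ t ∧ p s = p t := by
  by_contra! hcon
  apply hni
  have hc : Continuous p := hsmooth.continuous
  have hpi := Real.pi_pos
  set q : ℝ → ℂ := fun t => (p t).1 + (p t).2 * Complex.I with hq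
  have hqe : ∀ s t, q s = q t → p s = p t := by
    intro s t h
    have h1 := congrArg Complex.re h
    have h2 := congrArg Complex.im h
    simp [hq] at h1 h2
    exact Prod.ext h1 h2
  have main := aux_main q (by fun_prop) (2 * π) ℓ (by positivity) (by linarith)
    (fun s => by simp [hq, hper]; ring)
    (fun s t h1 h2 h => hcon s s t ⟨le_rfl, by linarith⟩ ⟨h1.le, h2⟩ h1.ne (hqe s t h))
  intro s t h
  by_contra hne
  rcases lt_or_gt_of_ne hne with hlt | hlt
  · exact main s t hlt (by simp only [hq, h])
  · exact main t s hlt (by simp only [hq, h])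
end

section
/- Let t₁ < s₁ and suppose the loop {P(s) : s ∈ [t₁, s₁]} on the cylinder has no crossings, i.e., for all t₁ ≤ s < t ≤ s₁ with (s, t) ≠ (t₁, s₁) it is not the case that u(t) − u(s) ∈ 2πℤ and v(t) = v(s). If P(s₁) = P(t₁), i.e., u(s₁) − u(t₁) = 2kπ for an integer k and v(s₁) = v(t₁), then |k| ≤ 1; that is, a simple (non-self-crossing) loop on the cylinder has winding number −1, 0, or 1. -/
open Real Set

/-- A continuous function on the unit interval avoiding a value and starting above it stays
above it. -/
lemma stays_above {f : ℝ → ℝ} (hf : Continuous f) {c : ℝ} (h0 : c < f 0)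
    (h : ∀ x ∈ Icc (0:ℝ) 1, f x ≠ c) : c < f 1 := by
  by_contra hc
  push Not at hc
  obtain ⟨x, hx, hxc⟩ := intermediate_value_Icc' (zero_le_one' ℝ) hf.continuousOn ⟨hc, h0.le⟩
  exact h x hx hxc

lemma stays_below {f : ℝ → ℝ} (hf : Continuous f) {c : ℝ} (h0 : f 0 < c)
    (h : ∀ x ∈ Icc (0:ℝ) 1, f x ≠ c) : f 1 < c := by
  by_contra hc
  push Not at hc
  obtain ⟨x, hx, hxc⟩ := intermediate_value_Icc (zero_le_one' ℝ) hf.continuousOn ⟨h0.le, hc⟩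
  exact h x hx hxc

/-- The angle version of the two dimensional Poincaré-Miranda theorem. -/
lemma no_angle (θ : ℝ × ℝ → ℝ) (hθ : Continuous θ)
    (hb : ∀ x ∈ Icc (0:ℝ) 1, cos (θ (x, 0)) < 0)
    (ht : ∀ x ∈ Icc (0:ℝ) 1, 0 < cos (θ (x, 1)))
    (hl : ∀ y ∈ Icc (0:ℝ) 1, 0 ≤ sin (θ (0, y)))
    (hr : ∀ y ∈ Icc (0:ℝ) 1, sin (θ (1, y)) ≤ 0) : False := by
  wlog h0 : 0 ≤ θ (0, 0) ∧ θ (0, 0) < 2 * π generalizing θ with H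
  · have hp : (0:ℝ) < 2 * π := by positivity
    set n : ℤ := ⌊θ (0, 0) / (2 * π)⌋ with hn
    refine H (fun q => θ q - n * (2 * π)) (by fun_prop) ?_ ?_ ?_ ?_ ?_
    · intro x hx; rw [cos_sub_int_mul_two_pi]; exact hb x hx
    · intro x hx; rw [cos_sub_int_mul_two_pi]; exact ht x hx
    · intro x hx; rw [sin_sub_int_mul_two_pi]; exact hl x hx
    · intro x hx; rw [sin_sub_int_mul_two_pi]; exact hr x hx
    · have h1 := Int.floor_le (θ (0, 0) / (2 * π))
      have h2 := Int.lt_floor_add_one (θ (0, 0) / (2 * π))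
      rw [← hn, le_div_iff₀ hp] at h1
      rw [← hn, div_lt_iff₀ hp] at h2
      constructor <;> linarith
  have z : (0:ℝ) ∈ Icc (0:ℝ) 1 := by simp
  have o : (1:ℝ) ∈ Icc (0:ℝ) 1 := by simp
  have hpi := pi_pos
  have c1 : cos (π / 2) = 0 := cos_pi_div_two
  have c3 : cos (3 * π / 2) = 0 := by
    rw [show 3 * π / 2 = π / 2 + π by ring, cos_add_pi]; simp
  have s1 : sin (π / 2) = 1 := sin_pi_div_two
  have s3 : sin (3 * π / 2) = -1 := by
    rw [show 3 * π / 2 = π / 2 + π by ring, sin_add_pi]; simp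
  have sm : sin (-(π / 2)) = -1 := by rw [sin_neg]; simp
  have cb := hb 0 z
  have a1 : π / 2 < θ (0, 0) := by
    by_contra h
    push Not at h
    have := cos_nonneg_of_mem_Icc (x := θ (0, 0)) ⟨by linarith, h⟩
    linarith
  have a2 : θ (0, 0) < 3 * π / 2 := by
    by_contra h
    push Not at h
    have := cos_nonneg_of_mem_Icc (x := θ (0, 0) - 2 * π) ⟨by linarith, by linarith⟩
    rw [cos_sub_two_pi] at this
    linarith
  -- left edge
  have l1 : θ (0, 1) < 3 * π / 2 :=
    stays_below (f := fun y => θ (0, y)) (by fun_prop) a2 (fun y hy e => by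
      have := hl y hy
      rw [e, s3] at this; linarith)
  have l2 : θ (0, 1) < π / 2 := by
    by_contra h
    push Not at h
    have := cos_nonpos_of_pi_div_two_le_of_le h (by linarith)
    have := ht 0 z
    linarith
  -- bottom edge
  have b1 : π / 2 < θ (1, 0) :=
    stays_above (f := fun x => θ (x, 0)) (by fun_prop) a1 (fun y hy e => by
      have := hb y hy
      rw [e, c1] at this; linarith)
  -- right edge
  have r1 : π / 2 < θ (1, 1) :=
    stays_above (f := fun y => θ (1, y)) (by fun_prop) b1 (fun y hy e => by
      have := hr y hy
      rw [e, s1] at this; linarith)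
  -- top edge
  have t1 : θ (1, 1) < π / 2 :=
    stays_below (f := fun x => θ (x, 1)) (by fun_prop) l2 (fun y hy e => by
      have := ht y hy
      rw [e, c1] at this; linarith)
  linarith

/-- Two dimensional Poincaré-Miranda theorem. -/
lemma miranda (F : ℝ × ℝ → ℂ) (hF : Continuous F)
    (hb : ∀ x ∈ Icc (0:ℝ) 1, (F (x, 0)).re < 0)
    (ht : ∀ x ∈ Icc (0:ℝ) 1, 0 < (F (x, 1)).re)
    (hl : ∀ y ∈ Icc (0:ℝ) 1, 0 ≤ (F (0, y)).im)
    (hr : ∀ y ∈ Icc (0:ℝ) 1, (F (1, y)).im ≤ 0) :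
    ∃ x ∈ Icc (0:ℝ) 1, ∃ y ∈ Icc (0:ℝ) 1, F (x, y) = 0 := by
  by_contra! hne
  let c : ℝ → ℝ := fun x => max 0 (min 1 x)
  have hc : Continuous c := by fun_prop
  have hcm : ∀ x, c x ∈ Icc (0:ℝ) 1 := fun x => ⟨le_max_left _ _, by simp [c]⟩
  have hce : ∀ x ∈ Icc (0:ℝ) 1, c x = x := fun x hx => by
    simp [c, hx.1, hx.2]
  let G : C(ℝ × ℝ, ℂ) := ⟨fun q => F (c q.1, c q.2), by fun_prop⟩
  have hG : ∀ q, G q ≠ 0 := fun q => hne _ (hcm _) _ (hcm _)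
  obtain ⟨L, ⟨-, hL⟩, -⟩ := Complex.isCoveringMapOn_exp.existsUnique_continuousMap_lifts
    G (Complex.exp_log (hG (0, 0))) (fun x => hG x)
  have hL' : ∀ q, Complex.exp (L q) = G q := fun q => congrFun hL q
  have e0 : c 0 = 0 := hce 0 (by simp)
  have e1 : c 1 = 1 := hce 1 (by simp)
  have hre : ∀ q, (G q).re = rexp (L q).re * cos (L q).im := fun q => by
    rw [← hL', Complex.exp_re]
  have him : ∀ q, (G q).im = rexp (L q).re * sin (L q).im := fun q => by
    rw [← hL', Complex.exp_im]
  refine no_angle (fun q => (L q).im) (by fun_prop) ?_ ?_ ?_ ?_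
  · intro x hx
    have := hb x hx
    have h2 : G (x, 0) = F (x, 0) := by simp [G, e0, hce x hx]
    rw [← h2, hre] at this
    exact neg_of_mul_neg_right this (exp_pos _).le
  · intro x hx
    have := ht x hx
    have h2 : G (x, 1) = F (x, 1) := by simp [G, e1, hce x hx]
    rw [← h2, hre] at this
    exact (mul_pos_iff_of_pos_left (exp_pos _)).1 this
  · intro x hx
    have := hl x hx
    have h2 : G (0, x) = F (0, x) := by simp [G, e0, hce x hx]
    rw [← h2, him] at this
    exact (mul_nonneg_iff_of_pos_left (exp_pos _)).1 this
  · intro x hx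
    have := hr x hx
    have h2 : G (1, x) = F (1, x) := by simp [G, e1, hce x hx]
    rw [← h2, him] at this
    exact (mul_nonpos_iff_pos_imp_nonpos.1 this).1 (exp_pos _)

/-- The main claim, for a positive winding number. -/
lemma winding_le_one (u v : ℝ → ℝ) (hcu : Continuous u) (hcv : Continuous v)
    (t₁ s₁ : ℝ) (hts : t₁ < s₁)
    (hnocross : ∀ s t : ℝ, t₁ ≤ s → s < t → t ≤ s₁ → (s, t) ≠ (t₁, s₁) →
      ¬ ((∃ m : ℤ, u t - u s = 2 * (m : ℝ) * Real.pi) ∧ v t = v s))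
    (k : ℤ) (hu : u s₁ - u t₁ = 2 * (k : ℝ) * Real.pi) (hv : v s₁ = v t₁) :
    k ≤ 1 := by
  by_contra! hk
  have hk2 : (2:ℝ) ≤ k := by exact_mod_cast hk
  have hpi := pi_pos
  have hne : (Icc t₁ s₁).Nonempty := ⟨t₁, by simp [hts.le]⟩
  obtain ⟨a, ha, hamin⟩ := isCompact_Icc.exists_isMinOn hne hcv.continuousOn
  obtain ⟨b, hb, hbmax⟩ := isCompact_Icc.exists_isMaxOn hne hcv.continuousOn
  set T := s₁ - t₁ with hT
  have hT0 : 0 < T := by linarith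
  -- the periodic extension
  let U : ℝ → ℝ := fun t => if t ≤ s₁ then u t else u (t - T) + 2 * k * π
  let V : ℝ → ℝ := fun t => if t ≤ s₁ then v t else v (t - T)
  have hUc : Continuous U := by
    refine Continuous.if_le hcu (by fun_prop) continuous_id continuous_const ?_
    intro x hx
    rw [hx, show s₁ - T = t₁ by rw [hT]; ring]; linarith
  have hVc : Continuous V := by
    refine Continuous.if_le hcv (by fun_prop) continuous_id continuous_const ?_
    intro x hx
    rw [hx, show s₁ - T = t₁ by rw [hT]; ring]; linarith
  have hUT : ∀ s ∈ Icc t₁ s₁, U (s + T) = u s + 2 * k * π := by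
    intro s hs
    by_cases h : s + T ≤ s₁
    · have : s = t₁ := by have := hs.1; linarith
      subst this
      simp only [U, if_pos h]
      rw [show s + T = s₁ by rw [hT]; ring]; linarith
    · simp [U, if_neg h]
  have hVmem : ∀ s ∈ Icc t₁ s₁, ∀ y ∈ Icc (0:ℝ) 1, ∃ r ∈ Icc t₁ s₁, V (s + y * T) = v r := by
    intro s hs y hy
    have h1 : 0 ≤ y * T := mul_nonneg hy.1 hT0.le
    have h2 : y * T ≤ T := by nlinarith [hy.2]
    by_cases h : s + y * T ≤ s₁
    · exact ⟨s + y * T, ⟨by linarith [hs.1], h⟩, by simp [V, h]⟩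
    · push Not at h
      exact ⟨s + y * T - T, ⟨by linarith, by linarith [hs.2]⟩, by simp [V, not_le.2 h]⟩
  let S : ℝ → ℝ := fun x => a + x * (b - a)
  have hS : ∀ x ∈ Icc (0:ℝ) 1, S x ∈ Icc t₁ s₁ := by
    intro x hx
    have := (convex_Icc t₁ s₁) ha hb (sub_nonneg.2 hx.2) hx.1 (by ring)
    simp only [smul_eq_mul] at this
    convert this using 1
    simp only [S]; ring
  let F : ℝ × ℝ → ℂ := fun q =>
    ⟨U (S q.1 + q.2 * T) - u (S q.1) - 2 * π, V (S q.1 + q.2 * T) - v (S q.1)⟩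
  have hFc : Continuous F := by
    have : F = fun q => ((U (S q.1 + q.2 * T) - u (S q.1) - 2 * π : ℝ) : ℂ)
      + ((V (S q.1 + q.2 * T) - v (S q.1) : ℝ) : ℂ) * Complex.I := by
      funext q; exact Complex.mk_eq_add_mul_I _ _
    rw [this]
    fun_prop
  obtain ⟨x, hx, y, hy, hxy⟩ := miranda F hFc
    (by
      intro x hx
      have h := (hS x hx).2
      simp only [F, U, zero_mul, add_zero, if_pos h]
      linarith)
    (by
      intro x hx
      have h := hUT _ (hS x hx)
      simp only [F, one_mul, h]
      nlinarith)
    (by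
      intro y hy
      have e : S 0 = a := by simp [S]
      obtain ⟨r, hr, h⟩ := hVmem a ha y hy
      simp only [F, e, h]
      have : v a ≤ v r := hamin hr
      linarith)
    (by
      intro y hy
      have e : S 1 = b := by simp [S]
      obtain ⟨r, hr, h⟩ := hVmem b hb y hy
      simp only [F, e, h]
      have : v r ≤ v b := hbmax hr
      linarith)
  have hs := hS x hx
  have hre : U (S x + y * T) - u (S x) - 2 * π = 0 := congrArg Complex.re hxy
  have him : V (S x + y * T) - v (S x) = 0 := congrArg Complex.im hxy
  generalize S x = s at hs hre him
  have h1 : 0 ≤ y * T := mul_nonneg hy.1 hT0.le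
  have h2 : y * T ≤ T := by nlinarith [hy.2]
  by_cases h : s + y * T ≤ s₁
  · simp only [U, V, if_pos h] at hre him
    have hlt : s < s + y * T := by
      rcases h1.eq_or_lt with e | e
      · rw [← e] at hre; simp only [add_zero] at hre; linarith
      · linarith
    refine hnocross s (s + y * T) hs.1 hlt h ?_ ⟨⟨1, by push_cast; linarith⟩, by linarith⟩
    intro e
    obtain ⟨e1, e2⟩ := Prod.mk.inj e
    rw [e2, e1] at hre
    nlinarith
  · simp only [U, V, if_neg h] at hre him
    push Not at h
    have hle : s + y * T - T ≤ s := by linarith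
    have hgt : t₁ < s + y * T - T := by linarith
    have hlt : s + y * T - T < s := by
      rcases hle.eq_or_lt with e | e
      · rw [e] at hre; nlinarith
      · exact e
    refine hnocross (s + y * T - T) s hgt.le hlt hs.2 ?_
      ⟨⟨k - 1, by push_cast; linarith⟩, by linarith⟩
    intro e
    have := (Prod.mk.inj e).1
    linarith

/-- A loop on the cylinder with no crossings has winding number
`-1`, `0` or `1`. -/
theorem stmt_11 (p : ℝ → ℝ × ℝ)
    (hsmooth : ContDiff ℝ (⊤ : ℕ∞) p)
    (hspeed : ∀ s : ℝ, ((deriv p s).1) ^ 2 + ((deriv p s).2) ^ 2 = 1)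
    (t₁ s₁ : ℝ) (hts : t₁ < s₁)
    (hnocross : ∀ s t : ℝ, t₁ ≤ s → s < t → t ≤ s₁ → (s, t) ≠ (t₁, s₁) →
      ¬ ((∃ m : ℤ, (p t).1 - (p s).1 = 2 * (m : ℝ) * Real.pi) ∧ (p t).2 = (p s).2))
    (k : ℤ)
    (hu : (p s₁).1 - (p t₁).1 = 2 * (k : ℝ) * Real.pi)
    (hv : (p s₁).2 = (p t₁).2) :
    |k| ≤ 1 := by
  have hc : Continuous p := hsmooth.continuous
  rw [abs_le]
  constructor
  · have := winding_le_one (fun s => -(p s).1) (fun s => (p s).2) (by fun_prop) (by fun_prop)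
      t₁ s₁ hts (by
        rintro s t h1 h2 h3 h4 ⟨⟨m, hm⟩, h5⟩
        exact hnocross s t h1 h2 h3 h4 ⟨⟨-m, by push_cast; linarith⟩, h5⟩)
      (-k) (by push_cast; linarith) hv
    linarith
  · exact winding_le_one (fun s => (p s).1) (fun s => (p s).2) (by fun_prop) (by fun_prop)
      t₁ s₁ hts hnocross k hu hv
end
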